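/- arXiv:0905.1685 — 3 statements merged into one kernel-verified Lean document; each statement's English description precedes it below -/
import Mathlib

section
/- Let u be a bounded viscosity solution of λ (det D²u)^p ≤ u_t ≤ Λ (det D²u)^p in Q₁ := B₁ × [−1,0]. Then there exists a constant C, depending only on n, p, λ, Λ and on sup_{Q₁} |u|, such that |u(x,t) − u(x,s)| ≤ C |t − s|^{1/(np+1)} for all x ∈ B_{1/2} and all t, s ∈ [−1/2, 0]. -/
open Set Metric MeasureTheory
open scoped RealInnerProductSpace

noncomputable section

abbrev E (n : ℕ) := EuclideanSpace ℝ (Fin n)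

variable {n : ℕ}

/-- The time derivative `∂ₜφ(x,t)`. -/
noncomputable def timeDeriv (φ : E n → ℝ → ℝ) (x : E n) (t : ℝ) : ℝ :=
  deriv (φ x) t

/-- The spatial Hessian matrix `D²φ(x,t)` (in the standard coordinates). -/
noncomputable def hessMatrix (φ : E n → ℝ → ℝ) (x : E n) (t : ℝ) :
    Matrix (Fin n) (Fin n) ℝ :=
  Matrix.of fun i j =>
    fderiv ℝ (fun y => fderiv ℝ (fun z => φ z t) y (EuclideanSpace.single j (1:ℝ))) x
      (EuclideanSpace.single i (1:ℝ))

/-- `φ` is an admissible test function near `(x₀,t₀)`: C² in `x` and C¹ in `t` nearby. -/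
def IsTestAt (φ : E n → ℝ → ℝ) (x₀ : E n) (t₀ : ℝ) : Prop :=
  ∃ ε > (0:ℝ),
    (∀ t ∈ ball t₀ ε, ContDiffOn ℝ 2 (fun x => φ x t) (ball x₀ ε)) ∧
    (∀ x ∈ ball x₀ ε, ContDiffOn ℝ 1 (fun t => φ x t) (ball t₀ ε))

/-- `u - φ` attains a local maximum at `(x₀,t₀)` among times `t ≤ t₀`,
relative to `closure Ω × [t₁,t₂]`. -/
def LocalMaxBelow (Ω : Set (E n)) (t₁ t₂ : ℝ) (u φ : E n → ℝ → ℝ)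
    (x₀ : E n) (t₀ : ℝ) : Prop :=
  ∃ ε > (0:ℝ), ∀ x ∈ closure Ω, ∀ t ∈ Icc t₁ t₂, t ≤ t₀ →
    dist x x₀ < ε → dist t t₀ < ε →
    u x t - φ x t ≤ u x₀ t₀ - φ x₀ t₀

/-- `u - φ` attains a local minimum at `(x₀,t₀)` among times `t ≤ t₀`. -/
def LocalMinBelow (Ω : Set (E n)) (t₁ t₂ : ℝ) (u φ : E n → ℝ → ℝ)
    (x₀ : E n) (t₀ : ℝ) : Prop :=
  ∃ ε > (0:ℝ), ∀ x ∈ closure Ω, ∀ t ∈ Icc t₁ t₂, t ≤ t₀ →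
    dist x x₀ < ε → dist t t₀ < ε →
    u x₀ t₀ - φ x₀ t₀ ≤ u x t - φ x t

/-- Viscosity subsolution of `u_t ≤ Λ (det D²u)^p` on `Ω × [t₁,t₂]`. -/
def ViscSubsolution (Lam p : ℝ) (Ω : Set (E n)) (t₁ t₂ : ℝ) (u : E n → ℝ → ℝ) : Prop :=
  ∀ x₀ ∈ Ω, ∀ t₀ ∈ Ioc t₁ t₂, ∀ φ : E n → ℝ → ℝ, IsTestAt φ x₀ t₀ →
    LocalMaxBelow Ω t₁ t₂ u φ x₀ t₀ →
    timeDeriv φ x₀ t₀ ≤ Lam * max (hessMatrix φ x₀ t₀).det 0 ^ p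

/-- Viscosity supersolution of `u_t ≥ λ (det D²u)^p` on `Ω × [t₁,t₂]`. -/
def ViscSupersolution (lam p : ℝ) (Ω : Set (E n)) (t₁ t₂ : ℝ) (u : E n → ℝ → ℝ) : Prop :=
  ∀ x₀ ∈ Ω, ∀ t₀ ∈ Ioc t₁ t₂, ∀ φ : E n → ℝ → ℝ, IsTestAt φ x₀ t₀ →
    LocalMinBelow Ω t₁ t₂ u φ x₀ t₀ →
    (hessMatrix φ x₀ t₀).PosSemidef →
    lam * (hessMatrix φ x₀ t₀).det ^ p ≤ timeDeriv φ x₀ t₀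

/-- The regularity/structure assumptions: continuity on `closure Ω × [t₁,t₂]`,
convexity in `x`, monotonicity in `t`. -/
structure ParabolicRegular (Ω : Set (E n)) (t₁ t₂ : ℝ) (u : E n → ℝ → ℝ) : Prop where
  cont : ContinuousOn (fun q : E n × ℝ => u q.1 q.2) (closure Ω ×ˢ Icc t₁ t₂)
  conv : ∀ t ∈ Icc t₁ t₂, ConvexOn ℝ (closure Ω) (fun x => u x t)
  mono : ∀ x ∈ closure Ω, ∀ s ∈ Icc t₁ t₂, ∀ t ∈ Icc t₁ t₂, s ≤ t → u x s ≤ u x t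

/-- Viscosity solution of `λ (det D²u)^p ≤ u_t ≤ Λ (det D²u)^p` on `Ω × [t₁,t₂]`. -/
def ViscositySolution (lam Lam p : ℝ) (Ω : Set (E n)) (t₁ t₂ : ℝ) (u : E n → ℝ → ℝ) : Prop :=
  ParabolicRegular Ω t₁ t₂ u ∧ ViscSubsolution Lam p Ω t₁ t₂ u ∧
    ViscSupersolution lam p Ω t₁ t₂ u

/-- `w` is `C^{1,α}` at `x₀` (relative to the set `D`) with some finite constant. -/
def C1AlphaAt (w : E n → ℝ) (D : Set (E n)) (α : ℝ) (x₀ : E n) : Prop :=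
  ∃ C a : ℝ, ∃ q : E n, ∀ x ∈ D, |w x - (a + ⟪q, x - x₀⟫)| ≤ C * ‖x - x₀‖ ^ (1 + α)

/-- `w` is `C^{1,α}` at `x₀` in the direction `e` (relative to the set `D`). -/
def C1AlphaDirAt (w : E n → ℝ) (D : Set (E n)) (α : ℝ) (x₀ e : E n) : Prop :=
  ∃ C a q : ℝ, ∀ s : ℝ, x₀ + s • e ∈ D →
    |w (x₀ + s • e) - (a + q * s)| ≤ C * |s| ^ (1 + α)

/-- A convex set `S` is `d`-balanced with respect to `x₀`. -/
def DBalanced (d : ℝ) (S : Set (E n)) (x₀ : E n) : Prop :=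
  ∃ A : E n →ₗ[ℝ] E n, Function.Bijective A ∧
    ball (0 : E n) 1 ⊆ A '' ((fun y => y - x₀) '' S) ∧
    A '' ((fun y => y - x₀) '' S) ⊆ ball (0 : E n) d

/-- `x₀` is an extremal point of the convex set `D`. -/
def ExtremalPoint (D : Set (E n)) (x₀ : E n) : Prop :=
  ¬ ∃ y ∈ closure D, ∃ z ∈ closure D, ∃ t : ℝ,
      0 < t ∧ t < 1 ∧ y ≠ z ∧ x₀ = t • y + (1 - t) • z

/-- The paraboloid with Hessian `c • 1` centred at `x₀`, moving upwards with speed `b`. -/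
def risingParaboloid (x₀ : E n) (c b : ℝ) (y : E n) (τ : ℝ) : ℝ :=
  c / 2 * ‖y - x₀‖ ^ 2 + b * τ

lemma isTestAt_risingParaboloid (x₀ : E n) (c b : ℝ) (x : E n) (t : ℝ) :
    IsTestAt (risingParaboloid x₀ c b) x t := by
  refine ⟨1, one_pos, fun τ _ => ContDiff.contDiffOn ?_, fun y _ => ContDiff.contDiffOn ?_⟩
  · have h : ContDiff ℝ 2 fun y : E n => ‖y - x₀‖ ^ 2 := (contDiff_id.sub contDiff_const).norm_sq ℝ
    exact (contDiff_const.mul h).add contDiff_const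
  · exact contDiff_const.add (contDiff_const.mul contDiff_id)

lemma timeDeriv_risingParaboloid (x₀ : E n) (c b : ℝ) (x : E n) (t : ℝ) :
    timeDeriv (risingParaboloid x₀ c b) x t = b := by
  have h : HasDerivAt (fun τ : ℝ => c / 2 * ‖x - x₀‖ ^ 2 + b * τ) (b * 1) t :=
    ((hasDerivAt_id t).const_mul b).const_add _
  exact h.deriv.trans (mul_one b)

lemma fderiv_risingParaboloid (x₀ : E n) (c b t : ℝ) (y v : E n) :
    fderiv ℝ (fun z => risingParaboloid x₀ c b z t) y v = c * ⟪y - x₀, v⟫ := by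
  have h : HasFDerivAt (fun z : E n => ‖z - x₀‖ ^ 2) _ y :=
    ((hasFDerivAt_id y).sub_const x₀).norm_sq
  have h' : HasFDerivAt (fun z => risingParaboloid x₀ c b z t) _ y :=
    (h.const_mul (c / 2)).add_const (b * t)
  rw [h'.fderiv]
  simp only [smul_apply, ContinuousLinearMap.comp_apply,
    ContinuousLinearMap.id_apply, innerSL_apply_apply, id_eq, smul_eq_mul, nsmul_eq_mul]
  push_cast
  ring

lemma hessMatrix_risingParaboloid (x₀ : E n) (c b : ℝ) (x : E n) (t : ℝ) :
    hessMatrix (risingParaboloid x₀ c b) x t = c • (1 : Matrix (Fin n) (Fin n) ℝ) := by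
  ext i j
  simp only [hessMatrix, Matrix.of_apply, fderiv_risingParaboloid]
  have h : HasFDerivAt (fun y : E n => ⟪y - x₀, EuclideanSpace.single j (1 : ℝ)⟫) _ x :=
    ((hasFDerivAt_id x).sub_const x₀).inner ℝ (hasFDerivAt_const (EuclideanSpace.single j 1) x)
  rw [(h.const_mul c).fderiv]
  simp [Matrix.one_apply, EuclideanSpace.inner_single_left]

/-- A subsolution lies below any strictly faster rising paraboloid that dominates it on the
parabolic boundary of `Ω × [s, t]`. -/
lemma ViscSubsolution.le_risingParaboloid {Lam p : ℝ} {Ω : Set (E n)} (hΩ : IsOpen Ω)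
    (hcpt : IsCompact (closure Ω)) {t₁ t₂ : ℝ} {u : E n → ℝ → ℝ}
    (hcont : ContinuousOn (fun q : E n × ℝ => u q.1 q.2) (closure Ω ×ˢ Icc t₁ t₂))
    (hsub : ViscSubsolution Lam p Ω t₁ t₂ u) {s t : ℝ} (hs : t₁ ≤ s) (ht : t ≤ t₂)
    {x₀ : E n} {c b a : ℝ} (hc : 0 ≤ c) (hb : Lam * (c ^ n) ^ p < b)
    (hinit : ∀ x ∈ closure Ω, u x s ≤ a + risingParaboloid x₀ c b x s)
    (hbdry : ∀ x ∈ frontier Ω, ∀ τ ∈ Icc s t, u x τ ≤ a + risingParaboloid x₀ c b x τ) :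
    ∀ x ∈ closure Ω, ∀ τ ∈ Icc s t, u x τ ≤ a + risingParaboloid x₀ c b x τ := by
  intro x hx τ hτ
  have hφ : Continuous fun q : E n × ℝ => risingParaboloid x₀ c b q.1 q.2 := by
    unfold risingParaboloid
    fun_prop
  have hcont' : ContinuousOn (fun q : E n × ℝ => u q.1 q.2 - risingParaboloid x₀ c b q.1 q.2)
      (closure Ω ×ˢ Icc s t) :=
    (hcont.mono (prod_mono_right (Icc_subset_Icc hs ht))).sub hφ.continuousOn
  obtain ⟨⟨y, σ⟩, ⟨hy, hσ⟩, hmax⟩ :=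
    (hcpt.prod isCompact_Icc).exists_isMaxOn ⟨(x, τ), hx, hτ⟩ hcont'
  have hle : ∀ z ∈ closure Ω, ∀ r ∈ Icc s t,
      u z r - risingParaboloid x₀ c b z r ≤ u y σ - risingParaboloid x₀ c b y σ :=
    fun z hz r hr => hmax (show (z, r) ∈ closure Ω ×ˢ Icc s t from ⟨hz, hr⟩)
  by_contra! hlt
  have hpos : a + risingParaboloid x₀ c b y σ < u y σ := by linarith [hle x hx τ hτ]
  have hyΩ : y ∈ Ω := by
    by_contra hyΩ
    exact hpos.not_ge (hbdry y ⟨hy, by rwa [hΩ.interior_eq]⟩ σ hσ)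
  have hsσ : s < σ := by
    refine lt_of_le_of_ne hσ.1 ?_
    rintro rfl
    exact hpos.not_ge (hinit y hy)
  have key := hsub y hyΩ σ ⟨hs.trans_lt hsσ, hσ.2.trans ht⟩ _
    (isTestAt_risingParaboloid x₀ c b y σ)
    ⟨σ - s, sub_pos.2 hsσ, fun z hz r _ hrσ _ hr =>
      hle z hz r ⟨by linarith [neg_abs_le (r - σ), Real.dist_eq r σ], hrσ.trans hσ.2⟩⟩
  rw [timeDeriv_risingParaboloid, hessMatrix_risingParaboloid, Matrix.det_smul, Matrix.det_one,
    mul_one, Fintype.card_fin, max_eq_left (pow_nonneg hc n)] at key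
  exact key.not_gt hb

/-- A convex function on the unit ball bounded by `M` grows at most linearly, with slope `4 * M`,
away from a point of the half ball. -/
lemma ConvexOn.le_add_four_mul_norm_sub {f : E n → ℝ} {M : ℝ}
    (hf : ConvexOn ℝ (closedBall (0 : E n) 1) f)
    (hM : ∀ x ∈ closedBall (0 : E n) 1, |f x| ≤ M) {x₀ : E n} (hx₀ : ‖x₀‖ < 1 / 2)
    {x : E n} (hx : x ∈ closedBall (0 : E n) 1) :
    f x ≤ f x₀ + 4 * M * ‖x - x₀‖ := by
  have hx₀' : x₀ ∈ closedBall (0 : E n) 1 := by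
    rw [mem_closedBall_zero_iff]
    linarith
  obtain ⟨h1, -⟩ := abs_le.1 (hM x₀ hx₀')
  obtain ⟨-, h2⟩ := abs_le.1 (hM x hx)
  have hM0 : 0 ≤ M := (abs_nonneg _).trans (hM x₀ hx₀')
  rcases lt_or_ge (1 / 2) ‖x - x₀‖ with hr | hr
  · nlinarith
  rcases eq_or_ne x x₀ with rfl | hne
  · simp
  have hr0 : 0 < ‖x - x₀‖ := norm_pos_iff.2 (sub_ne_zero.2 hne)
  set r := ‖x - x₀‖
  set z : E n := x₀ + (1 / (2 * r)) • (x - x₀)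
  have hz : z ∈ closedBall (0 : E n) 1 := by
    rw [mem_closedBall_zero_iff]
    have h3 : ‖(1 / (2 * r)) • (x - x₀)‖ = 1 / 2 := by
      rw [norm_smul, Real.norm_of_nonneg (by positivity)]
      change 1 / (2 * r) * r = 1 / 2
      field_simp
    linarith [norm_add_le x₀ ((1 / (2 * r)) • (x - x₀))]
  have hxz : (1 - 2 * r) • x₀ + (2 * r) • z = x := by
    have h4 : 2 * r * (1 / (2 * r)) = 1 := by field_simp
    rw [smul_add, smul_smul, h4, sub_smul, one_smul, one_smul]
    abel
  have h5 := hf.2 hx₀' hz (by linarith : (0 : ℝ) ≤ 1 - 2 * r) (by positivity : 0 ≤ 2 * r) (by ring)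
  rw [hxz, smul_eq_mul, smul_eq_mul] at h5
  nlinarith [(abs_le.1 (hM z hz)).2]

/-- One-sided increment bound coming from the barrier that opens at scale `h`. -/
lemma ViscositySolution.sub_le_of_scale {lam Lam p M : ℝ} {u : E n → ℝ → ℝ}
    (hu : ViscositySolution lam Lam p (ball (0 : E n) 1) (-1) 0 u)
    (hLam : 0 ≤ Lam)
    (hM : ∀ x ∈ closure (ball (0 : E n) 1), ∀ t ∈ Icc (-1 : ℝ) 0, |u x t| ≤ M)
    {x₀ : E n} (hx₀ : ‖x₀‖ < 1 / 2) {s t : ℝ} (hs : -1 ≤ s) (hst : s ≤ t) (ht : t ≤ 0)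
    {h b : ℝ} (hh : 0 < h) (hb : Lam * ((4 * M / h) ^ n) ^ p < b) :
    u x₀ t - u x₀ s ≤ 2 * M * h + b * (t - s) := by
  obtain ⟨⟨hcont, hconv, -⟩, hsub, -⟩ := hu
  have hcl : closure (ball (0 : E n) 1) = closedBall 0 1 := closure_ball 0 one_ne_zero
  have hx₀' : x₀ ∈ closure (ball (0 : E n) 1) := subset_closure (by
    rw [mem_ball_zero_iff]
    linarith)
  have hsI : s ∈ Icc (-1 : ℝ) 0 := ⟨hs, hst.trans ht⟩
  have hM0 : 0 ≤ M := (abs_nonneg _).trans (hM x₀ hx₀' s hsI)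
  have hc : 0 ≤ 4 * M / h := by positivity
  have hb0 : 0 ≤ b :=
    (mul_nonneg hLam (Real.rpow_nonneg (pow_nonneg hc n) p)).trans hb.le
  set a := u x₀ s + 2 * M * h - b * s with ha
  have hcone : ∀ (x : E n) (τ : ℝ), s ≤ τ →
      u x₀ s + 4 * M * ‖x - x₀‖ ≤ a + risingParaboloid x₀ (4 * M / h) b x τ := by
    intro x τ hτ
    have h1 : 0 ≤ 2 * M / h * (‖x - x₀‖ - h) ^ 2 := by positivity
    have h2 : 2 * M / h * (‖x - x₀‖ - h) ^ 2
        = 4 * M / h / 2 * ‖x - x₀‖ ^ 2 - 4 * M * ‖x - x₀‖ + 2 * M * h := by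
      field_simp
      ring
    have h3 := mul_le_mul_of_nonneg_left hτ hb0
    rw [ha, risingParaboloid]
    linarith
  have hfin := hsub.le_risingParaboloid isOpen_ball
    (hcl ▸ isCompact_closedBall (0 : E n) 1) hcont hs ht (a := a) (x₀ := x₀) hc hb
    (fun x hx => (ConvexOn.le_add_four_mul_norm_sub (hcl ▸ hconv s hsI)
      (fun y hy => hM y (hcl ▸ hy) s hsI) hx₀ (hcl ▸ hx)).trans (hcone x s le_rfl))
    (fun x hx τ hτ => by
      refine le_trans ?_ (hcone x τ hτ.1)
      have hx1 : ‖x‖ = 1 := by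
        rwa [frontier_ball (0 : E n) one_ne_zero, mem_sphere_zero_iff_norm] at hx
      have h1 := (abs_le.1 (hM x (frontier_subset_closure hx) τ
        ⟨hs.trans hτ.1, hτ.2.trans ht⟩)).2
      have h2 := (abs_le.1 (hM x₀ hx₀' s hsI)).1
      have h3 : 1 / 2 ≤ ‖x - x₀‖ := by linarith [norm_sub_norm_le x x₀]
      nlinarith)
    x₀ hx₀' t ⟨hst, le_rfl⟩
  rw [ha, risingParaboloid, sub_self, norm_zero] at hfin
  linarith

/-- Corollary 3.3: interior Hölder continuity in time with exponent
`1/(np+1)`. -/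
theorem stmt16 (n : ℕ) (hn : 1 ≤ n) (p lam Lam : ℝ)
    (hp : 0 < p) (hlam : 0 < lam) (hll : lam ≤ Lam) (M : ℝ) :
    ∃ C : ℝ,
      ∀ u : E n → ℝ → ℝ,
        ViscositySolution lam Lam p (ball (0 : E n) 1) (-1) 0 u →
        (∀ x ∈ closure (ball (0 : E n) 1), ∀ t ∈ Icc (-1 : ℝ) 0, |u x t| ≤ M) →
        ∀ x ∈ ball (0 : E n) (1/2), ∀ t ∈ Icc (-(1:ℝ)/2) 0, ∀ s ∈ Icc (-(1:ℝ)/2) 0,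
          |u x t - u x s| ≤ C * |t - s| ^ (1 / ((n : ℝ) * p + 1)) := by
  refine ⟨2 * M + (Lam * ((4 * M) ^ n) ^ p + 1), fun u hu hM x hx => ?_⟩
  have hLam : 0 ≤ Lam := hlam.le.trans hll
  have hx' : ‖x‖ < 1 / 2 := mem_ball_zero_iff.1 hx
  have hxcl : x ∈ closure (ball (0 : E n) 1) := subset_closure (by
    rw [mem_ball_zero_iff]
    linarith)
  have hM0 : 0 ≤ M := (abs_nonneg _).trans (hM x hxcl 0 (by norm_num))
  have hnp : (0 : ℝ) < n * p + 1 := by positivity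
  have main : ∀ t ∈ Icc (-(1 : ℝ) / 2) 0, ∀ s ∈ Icc (-(1 : ℝ) / 2) 0, s ≤ t →
      |u x t - u x s| ≤ (2 * M + (Lam * ((4 * M) ^ n) ^ p + 1)) *
        |t - s| ^ (1 / ((n : ℝ) * p + 1)) := by
    intro t ht s hs hst
    have hs1 : -1 ≤ s := by linarith [hs.1]
    have hmono := hu.1.mono x hxcl s ⟨hs1, hs.2⟩ t ⟨hs1.trans hst, ht.2⟩ hst
    rw [abs_of_nonneg (sub_nonneg.2 hmono), abs_of_nonneg (sub_nonneg.2 hst)]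
    rcases hst.eq_or_lt with rfl | hlt
    · rw [sub_self, sub_self, Real.zero_rpow (by positivity), mul_zero]
    have hd : 0 < t - s := sub_pos.2 hlt
    set h := (t - s) ^ (1 / ((n : ℝ) * p + 1)) with hh
    have hh0 : 0 < h := Real.rpow_pos_of_pos hd _
    have hq : 0 < (h ^ n) ^ p := Real.rpow_pos_of_pos (pow_pos hh0 n) p
    have hscale : (h ^ n) ^ p * h = t - s := by
      rw [← Real.rpow_natCast h n, ← Real.rpow_mul hh0.le, ← Real.rpow_add_one hh0.ne', hh,
        ← Real.rpow_mul hd.le, one_div, inv_mul_cancel₀ hnp.ne', Real.rpow_one]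
    have hb : Lam * ((4 * M / h) ^ n) ^ p < (Lam * ((4 * M) ^ n) ^ p + 1) / (h ^ n) ^ p := by
      rw [div_pow, Real.div_rpow (by positivity) (by positivity), ← mul_div_assoc]
      gcongr
      linarith
    have hkey := hu.sub_le_of_scale hLam hM hx' hs1 hst ht.2 hh0 hb
    refine hkey.trans_eq ?_
    rw [← hscale]
    field_simp
  intro t ht s hs
  rcases le_total s t with hst | hst
  · exact main t ht s hs hst
  · rw [abs_sub_comm (u x t), abs_sub_comm t]
    exact main s hs t ht hst
end
end

section
/- (a) Let w be a convex function on a convex set Ω ⊆ ℝⁿ with 0 ∈ Ω and w(0) = 0, and suppose the sublevel set S₁ := {x ∈ Ω : w(x) < 1} has compact closure contained in Ω and is d-balanced with respect to 0. Then there is a constant C_n > 0 depending only on n such that for every h ∈ (0,1) there exists q ∈ ℝⁿ for which the section S_h := {x ∈ Ω : w(x) < h + q·x} satisfies S_h ⊆ S₁ and S_h is C_n·d-balanced with respect to 0. (b) For x ∈ S₁ let r(x) denote the supremum of the volumes of ellipsoids centered at x and contained in S₁. Then there is a constant C_n′ > 0 depending only on n such that the section S_h in part (a) can be chosen so that either S_h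 is C_n′-balanced with respect to 0, or r(x*) ≥ 2 r(0), where x* is the center of mass of S_h. -/
open Set Metric MeasureTheory
open scoped RealInnerProductSpace

noncomputable section

variable {n : ℕ}

/-- The center of mass of a set. -/
noncomputable def centerOfMass {n : ℕ} (S : Set (E n)) : E n :=
  (volume S).toReal⁻¹ • ∫ y in S, y

/-- The supremum of the volumes of ellipsoids centered at `x` and contained in `S₁`. -/
noncomputable def maxEllVol {n : ℕ} (S₁ : Set (E n)) (x : E n) : ℝ :=
  sSup {v : ℝ | ∃ A : E n →ₗ[ℝ] E n, Function.Bijective A ∧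
    (fun y => x + A y) '' closedBall (0 : E n) 1 ⊆ S₁ ∧
    v = (volume ((fun y => x + A y) '' closedBall (0 : E n) 1)).toReal}

/-- Vectors of `K` spanning maximal volume form a basis in which `K` has coordinates in
`[-1, 1]`. -/
theorem exists_basis_mem_abs_repr_le_one {K : Set (E n)} (hK : IsCompact K)
    (h0 : (0 : E n) ∈ interior K) :
    ∃ b : Module.Basis (Fin n) ℝ (E n),
      (∀ i, b i ∈ K) ∧ ∀ x ∈ K, ∀ i, |b.repr x i| ≤ 1 := by
  set e : Module.Basis (Fin n) ℝ (E n) := (EuclideanSpace.basisFun (Fin n) ℝ).toBasis with he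
  have hcont : Continuous fun v : Fin n → E n => |e.det v| := by
    simp only [Module.Basis.det_apply]
    refine continuous_abs.comp (Continuous.matrix_det ?_)
    refine continuous_matrix fun i j => ?_
    simp only [Module.Basis.toMatrix_apply, he, OrthonormalBasis.coe_toBasis_repr_apply,
      EuclideanSpace.basisFun_repr]
    fun_prop
  have h0K : (0 : E n) ∈ K := interior_subset h0
  obtain ⟨v, hvK, hv⟩ := (isCompact_univ_pi fun _ : Fin n => hK).exists_isMaxOn
    ⟨fun _ => 0, fun _ _ => h0K⟩ hcont.continuousOn
  have hpos : 0 < |e.det v| := by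
    obtain ⟨r, hr, hrK⟩ := Metric.mem_nhds_iff.1 (mem_interior_iff_mem_nhds.1 h0)
    have hmem : (fun i => (r / 2) • e i) ∈ Set.pi univ fun _ : Fin n => K := by
      intro i _
      apply hrK
      simp [he, norm_smul, abs_of_pos hr]
      linarith
    refine lt_of_lt_of_le ?_ (hv hmem)
    have : e.det (fun i => (r / 2) • e i) = (r / 2) ^ n := by
      rw [AlternatingMap.map_smul_univ]
      simp [e.det_self, div_pow]
    simp only [this]
    positivity
  have hunit : IsUnit (e.det v) := isUnit_iff_ne_zero.2 (abs_pos.1 hpos)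
  obtain ⟨hli, hsp⟩ := (Module.Basis.is_basis_iff_det e).2 hunit
  refine ⟨Module.Basis.mk hli hsp.ge, fun i => by simpa using hvK i (mem_univ i), ?_⟩
  intro x hx i
  have h1 := LinearMap.congr_fun
    (Module.Basis.det_smul_mk_coord_eq_det_update e hli hsp.ge i) x
  simp only [LinearMap.smul_apply, smul_eq_mul, Module.Basis.coord_apply,
    MultilinearMap.toLinearMap_apply] at h1
  have h2 : Function.update v i x ∈ Set.pi univ fun _ : Fin n => K := by
    intro j _
    by_cases hj : j = i
    · subst hj; simpa using hx
    · simpa [hj] using hvK j (mem_univ j)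
  have h3 : |e.det (Function.update v i x)| ≤ |e.det v| := hv h2
  have h4 : |e.det v| * |(Module.Basis.mk hli hsp.ge).repr x i| ≤ |e.det v| := by
    rw [← abs_mul, h1]; exact h3
  nlinarith

/-- A bounded convex body around the origin is, up to a linear change of coordinates, trapped
between two balls whose radii depend only on the dimension. -/
theorem exists_linearEquiv_ball_subset {S : Set (E n)} (hS : Convex ℝ S)
    (hb : Bornology.IsBounded S) (h0 : (0 : E n) ∈ interior S) :
    ∃ (L : E n ≃ₗ[ℝ] E n) (p : E n), (∀ x ∈ S, ‖L x‖ < n + 1) ∧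
      ∀ u, ‖u - p‖ < 1 / (2 * (n + 1)) → L.symm u ∈ interior S := by
  obtain ⟨b, hbK, hb1⟩ := exists_basis_mem_abs_repr_le_one hb.isCompact_closure
    (interior_mono subset_closure h0)
  set L : E n ≃ₗ[ℝ] E n := b.equivFun.trans (WithLp.linearEquiv 2 ℝ (Fin n → ℝ)).symm with hL
  have hLi : ∀ x i, L x i = b.repr x i := fun x i => by simp [hL]
  refine ⟨L, WithLp.toLp 2 fun _ => 1 / (2 * (n + 1) : ℝ), ?_, ?_⟩
  · intro x hx
    have h1 : ‖L x‖ ^ 2 ≤ n := by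
      rw [EuclideanSpace.norm_sq_eq]
      calc ∑ i, ‖L x i‖ ^ 2 ≤ ∑ _i : Fin n, (1 : ℝ) := by
            refine Finset.sum_le_sum fun i _ => ?_
            rw [hLi, Real.norm_eq_abs]
            exact pow_le_one₀ (abs_nonneg _) (hb1 x (subset_closure hx) i)
        _ = n := by simp
    have hn : (0 : ℝ) ≤ n := Nat.cast_nonneg n
    nlinarith [norm_nonneg (L x)]
  · have hsub : L.symm '' ball (WithLp.toLp 2 fun _ => 1 / (2 * (n + 1) : ℝ))
        (1 / (2 * (n + 1))) ⊆ closure S := by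
      rintro _ ⟨u, hu, rfl⟩
      have hui : ∀ i, 0 ≤ u i ∧ u i ≤ 1 / (n + 1) := by
        intro i
        have h1 := (PiLp.norm_apply_le (u - WithLp.toLp 2 fun _ => 1 / (2 * (n + 1) : ℝ)) i).trans
          (mem_ball_iff_norm.1 hu).le
        simp only [PiLp.sub_apply, Real.norm_eq_abs] at h1
        have h2 : 1 / (n + 1 : ℝ) = 1 / (2 * (n + 1)) + 1 / (2 * (n + 1)) := by
          field_simp; norm_num
        rw [abs_le] at h1
        constructor <;> linarith
      have hsum : L.symm u = ∑ i, u i • b i := by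
        simp [hL, Module.Basis.equivFun_symm_apply]
      have hle : ∑ i, u i ≤ 1 := by
        calc ∑ i, u i ≤ ∑ _i : Fin n, 1 / (n + 1 : ℝ) := Finset.sum_le_sum fun i _ => (hui i).2
          _ ≤ 1 := by
            simp only [Finset.sum_const, Finset.card_univ, Fintype.card_fin, nsmul_eq_mul]
            rw [mul_one_div, div_le_one (by positivity)]
            linarith
      have h0S : (0 : E n) ∈ closure S := subset_closure (interior_subset h0)
      have h := hS.closure.sum_mem (t := (Finset.univ : Finset (Option (Fin n))))
        (w := fun o => o.elim (1 - ∑ i, u i) fun i => u i)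
        (z := fun o => o.elim 0 fun i => b i) (by
          rintro (_ | i) _
          · simpa using hle
          · exact (hui i).1) (by simp [Fintype.sum_option]) (by
          rintro (_ | i) _
          · exact h0S
          · exact hbK i)
      simpa [Fintype.sum_option, hsum] using h
    intro u hu
    rw [← hS.interior_closure_eq_interior_of_nonempty_interior ⟨0, h0⟩]
    refine interior_maximal hsub ?_ ⟨u, mem_ball_iff_norm.2 hu, rfl⟩
    exact L.toContinuousLinearEquiv.symm.toHomeomorph.isOpenMap _ isOpen_ball

theorem centerOfMass_eq_setAverage (S : Set (E n)) : centerOfMass S = ⨍ y in S, y := by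
  rw [centerOfMass, setAverage_eq, measureReal_def]

/-- Splitting off a measurable piece `B` of a bounded convex set writes its center of mass as a
convex combination of the average over `B` and of a point of the closure. -/
theorem exists_centerOfMass_eq {S B : Set (E n)} (hS : Convex ℝ S) (hb : Bornology.IsBounded S)
    (hB : MeasurableSet B) (hBS : B ⊆ S) (hBpos : 0 < volume.real B) :
    ∃ z ∈ closure S, centerOfMass S = (volume.real B / volume.real S) • (⨍ y in B, y) +
      (1 - volume.real B / volume.real S) • z := by
  have hSfin : volume S ≠ ⊤ := hb.measure_lt_top.ne
  have hBfin : volume B ≠ ⊤ := ne_top_of_le_ne_top hSfin (measure_mono hBS)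
  have hint : IntegrableOn (fun y : E n => y) S volume :=
    (continuousOn_id.integrableOn_compact hb.isCompact_closure).mono_set subset_closure
  obtain ⟨z₀, hz₀⟩ : (closure S).Nonempty := by
    rcases B.eq_empty_or_nonempty with h | h
    · simp [h] at hBpos
    · exact (h.mono hBS).closure
  have hDfin : volume (S \ B) ≠ ⊤ := ne_top_of_le_ne_top hSfin (measure_mono sdiff_subset)
  have hSD : volume.real S = volume.real (S \ B) + volume.real B := by
    conv_lhs => rw [← sdiff_union_of_subset hBS]
    exact measureReal_union disjoint_sdiff_left hB hDfin hBfin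
  have hav := average_union (μ := (volume : Measure (E n))) (f := fun y => y)
    (disjoint_sdiff_left : Disjoint (S \ B) B).aedisjoint
    hB.nullMeasurableSet hDfin hBfin
    (hint.mono_set sdiff_subset) (hint.mono_set hBS)
  rw [sdiff_union_of_subset hBS, ← hSD, ← centerOfMass_eq_setAverage] at hav
  have hSpos : 0 < volume.real S := by
    have : 0 ≤ volume.real (S \ B) := measureReal_nonneg
    linarith
  have hθ : volume.real (S \ B) / volume.real S = 1 - volume.real B / volume.real S := by
    rw [eq_sub_iff_add_eq, ← add_div, ← hSD, div_self hSpos.ne']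
  by_cases hD : volume (S \ B) = 0
  · refine ⟨z₀, hz₀, ?_⟩
    rw [hav, ← hθ, measureReal_def, hD]
    simp
  · refine ⟨⨍ y in S \ B, y, ?_, ?_⟩
    · refine hS.closure.set_average_mem isClosed_closure hD hDfin ?_
        (hint.mono_set sdiff_subset)
      exact ae_restrict_of_ae_restrict_of_subset (sdiff_subset.trans subset_closure)
        (ae_restrict_mem isClosed_closure.measurableSet)
    · rw [hav, hθ, add_comm]

/-- The center of mass of a bounded convex body is quantitatively deep inside the body. -/
theorem exists_linearEquiv_ball_centerOfMass (n : ℕ) :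
    ∃ c : ℝ, 0 < c ∧ ∃ R : ℝ, 0 < R ∧ ∀ S : Set (E n), Convex ℝ S → Bornology.IsBounded S →
      (0 : E n) ∈ interior S → ∃ L : E n ≃ₗ[ℝ] E n, (∀ x ∈ S, ‖L x‖ < R) ∧
        ∀ u, ‖u - L (centerOfMass S)‖ < c → L.symm u ∈ interior S := by
  obtain ⟨r, hr⟩ : ∃ r : ℝ, r = 1 / (4 * (n + 1)) := ⟨_, rfl⟩
  have hr0 : 0 < r := by rw [hr]; positivity
  obtain ⟨k, hk⟩ : ∃ k : ℝ, k = (r / (n + 1)) ^ n := ⟨_, rfl⟩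
  have hk0 : 0 < k := by rw [hk]; positivity
  refine ⟨k * r, by positivity, n + 1, by positivity, fun S hS hb h0 => ?_⟩
  obtain ⟨L, p, hLR, hLp⟩ := exists_linearEquiv_ball_subset hS hb h0
  refine ⟨L, hLR, fun u hu => ?_⟩
  have h2r : 1 / (2 * (n + 1) : ℝ) = r + r := by rw [hr]; field_simp; norm_num
  rw [h2r] at hLp
  have hLc : Continuous L := L.toContinuousLinearEquiv.continuous
  set B : Set (E n) := L ⁻¹' ball p r with hB
  have hBS : B ⊆ S := fun x hx => by
    have h1 : ‖L x - p‖ < r := mem_ball_iff_norm.1 hx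
    have := hLp (L x) (by linarith)
    rw [L.symm_apply_apply] at this
    exact interior_subset this
  have hBo : IsOpen B := isOpen_ball.preimage hLc
  have hSfin : volume S ≠ ⊤ := hb.measure_lt_top.ne
  have hBfin : volume B ≠ ⊤ := ne_top_of_le_ne_top hSfin (measure_mono hBS)
  have hBne : B.Nonempty := ⟨L.symm p, by simp [hB, hr0]⟩
  have hBpos : 0 < volume.real B :=
    ENNReal.toReal_pos (hBo.measure_pos volume hBne).ne' hBfin
  have hvol : k * volume.real S ≤ volume.real B := by
    have h1 : volume.real S ≤ volume.real (L ⁻¹' ball 0 (n + 1)) := by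
      refine measureReal_mono (fun x hx => by simpa using hLR x hx) ?_
      rw [Measure.addHaar_preimage_linearEquiv]
      exact ENNReal.mul_ne_top ENNReal.ofReal_ne_top measure_ball_lt_top.ne
    have h2 : volume.real B = k * volume.real (L ⁻¹' ball 0 (n + 1)) := by
      rw [measureReal_def, measureReal_def, hB, Measure.addHaar_preimage_linearEquiv,
        Measure.addHaar_preimage_linearEquiv]
      have h3 := Measure.addHaar_ball_mul_of_pos (volume : Measure (E n)) p
        (show 0 < r / (n + 1) by positivity) (n + 1)
      rw [div_mul_cancel₀ _ (by positivity)] at h3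
      rw [h3, finrank_euclideanSpace_fin, ← hk, mul_left_comm, ENNReal.toReal_mul,
        ENNReal.toReal_ofReal hk0.le]
    rw [h2]
    exact mul_le_mul_of_nonneg_left h1 hk0.le
  have hint : IntegrableOn (fun y : E n => y) S volume :=
    (continuousOn_id.integrableOn_compact hb.isCompact_closure).mono_set subset_closure
  set p' : E n := ⨍ y in B, y with hp'
  have hp'B : ‖L p' - p‖ ≤ r := by
    have h1 : p' ∈ L ⁻¹' closedBall p r := by
      refine Convex.set_average_mem ?_ (isClosed_closedBall.preimage hLc)
        (hBo.measure_pos volume hBne).ne' hBfin ?_ (hint.mono_set hBS)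
      · exact (convex_closedBall p r).linear_preimage (L : E n →ₗ[ℝ] E n)
      · refine (ae_restrict_mem hBo.measurableSet).mono fun x hx => ?_
        have hx' : L x ∈ ball p r := hx
        exact mem_preimage.2 (ball_subset_closedBall hx')
    simpa [dist_eq_norm] using h1
  obtain ⟨θ, hθ⟩ : ∃ θ : ℝ, θ = volume.real B / volume.real S := ⟨_, rfl⟩
  have hSpos : 0 < volume.real S := hBpos.trans_le (measureReal_mono hBS hSfin)
  have hθk : k ≤ θ := by rw [hθ]; exact (le_div_iff₀ hSpos).2 hvol
  have hθ1 : θ ≤ 1 := by rw [hθ]; exact (div_le_one hSpos).2 (measureReal_mono hBS hSfin)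
  obtain ⟨z, hzS, hz⟩ := exists_centerOfMass_eq hS hb hBo.measurableSet hBS hBpos
  rw [← hθ, ← hp'] at hz
  have hθ0 : 0 < θ := hk0.trans_le hθk
  set v := u - L (centerOfMass S) with hv
  have hv' : ‖θ⁻¹ • v‖ < r := by
    rw [norm_smul, norm_inv, Real.norm_eq_abs, abs_of_pos hθ0, inv_mul_lt_iff₀ hθ0]
    exact hu.trans_le (mul_le_mul_of_nonneg_right hθk hr0.le)
  have hy : L.symm (L p' + θ⁻¹ • v) ∈ interior S := by
    refine hLp _ ?_
    calc ‖L p' + θ⁻¹ • v - p‖ = ‖(L p' - p) + θ⁻¹ • v‖ := by congr 1; abel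
      _ < r + r := (norm_add_le _ _).trans_lt (add_lt_add_of_le_of_lt hp'B hv')
  have hu' : L.symm u = θ • L.symm (L p' + θ⁻¹ • v) + (1 - θ) • z := by
    apply L.injective
    have : u = L (centerOfMass S) + v := by rw [hv]; abel
    rw [this, hz]
    simp [smul_smul, hθ0.ne']
    abel
  rw [hu']
  exact hS.combo_interior_closure_mem_interior hy hzS hθ0 (by linarith) (by ring)

theorem hasDerivAt_integral_max_add_mul {α : Type*} [MeasurableSpace α] {μ : Measure α}
    {a g : α → ℝ} (ha : Integrable a μ) (hg : Integrable g μ) (hne : ∀ᵐ x ∂μ, a x ≠ 0) :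
    HasDerivAt (fun t : ℝ => ∫ x, max (a x + t * g x) 0 ∂μ) (∫ x in {x | 0 < a x}, g x ∂μ) 0 := by
  have hs : NullMeasurableSet {x | 0 < a x} μ :=
    nullMeasurableSet_lt aemeasurable_const ha.aemeasurable
  have hmeas : ∀ t : ℝ, AEStronglyMeasurable (fun x => max (a x + t * g x) 0) μ := fun t =>
    (ha.add (hg.const_mul t)).pos_part.aestronglyMeasurable
  rw [← integral_indicator₀ hs]
  refine (hasDerivAt_integral_of_dominated_loc_of_lip (s := univ) (bound := g)
    Filter.univ_mem (Filter.Eventually.of_forall hmeas) ?_ ?_ ?_ hg ?_).2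
  · simpa using ha.pos_part
  · exact hg.aestronglyMeasurable.indicator₀ hs
  · refine Filter.Eventually.of_forall fun x => LipschitzOnWith.of_dist_le_mul fun s _ t _ => ?_
    simp only [Real.dist_eq, Real.coe_nnabs]
    refine (abs_max_sub_max_le_abs _ _ _).trans (le_of_eq ?_)
    rw [← abs_mul]
    congr 1
    ring
  · filter_upwards [hne] with x hx
    have hlin : HasDerivAt (fun t : ℝ => a x + t * g x) (g x) 0 := by
      simpa using ((hasDerivAt_id (0 : ℝ)).mul_const (g x)).const_add (a x)
    have hcont : Filter.Tendsto (fun t : ℝ => a x + t * g x) (nhds 0) (nhds (a x)) := by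
      simpa using hlin.continuousAt.tendsto
    rcases lt_or_gt_of_ne hx with h | h
    · have hd : HasDerivAt (fun t : ℝ => max (a x + t * g x) 0) 0 0 :=
        (hasDerivAt_const (0 : ℝ) (0 : ℝ)).congr_of_eventuallyEq
          ((hcont.eventually_lt_const h).mono fun t ht => max_eq_right ht.le)
      simpa [indicator, h.not_gt] using hd
    · have hd : HasDerivAt (fun t : ℝ => max (a x + t * g x) 0) (g x) 0 :=
        hlin.congr_of_eventuallyEq
          ((hcont.eventually_const_lt h).mono fun t ht => max_eq_left ht.le)
      simpa [indicator, h] using hd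

theorem ConvexOn.concaveOn_add_inner_sub {K : Set (E n)} {w : E n → ℝ} (hw : ConvexOn ℝ K w)
    (h : ℝ) (q : E n) : ConcaveOn ℝ K fun x => h + ⟪q, x⟫ - w x := by
  refine ⟨hw.1, fun x hx y hy s t hs ht hst => ?_⟩
  have h1 := hw.2 hx hy hs ht hst
  simp only [smul_eq_mul, inner_add_right, real_inner_smul_right] at h1 ⊢
  have h2 : h = s * h + t * h := by rw [← add_mul, hst, one_mul]
  nlinarith

theorem ConvexOn.convex_section {K : Set (E n)} {w : E n → ℝ} (hw : ConvexOn ℝ K w)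
    (h : ℝ) (q : E n) : Convex ℝ {x ∈ K | w x < h + ⟪q, x⟫} := by
  have := (hw.concaveOn_add_inner_sub h q).convex_gt 0
  simpa only [sub_pos] using this

/-- A convex function lying strictly below an affine function at the origin agrees with it only
on a null set. -/
theorem ae_add_inner_sub_ne_zero {K : Set (E n)} {w : E n → ℝ} (hw : ConvexOn ℝ K w)
    (h0 : (0 : E n) ∈ K) (hw0 : w 0 = 0) {h : ℝ} (hh : 0 < h) (q : E n) :
    ∀ᵐ x ∂volume.restrict (interior K), h + ⟪q, x⟫ - w x ≠ 0 := by
  rw [ae_restrict_iff' isOpen_interior.measurableSet]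
  refine measure_mono_null ?_ ((hw.convex_section h q).addHaar_frontier volume)
  intro x hx
  simp only [mem_compl_iff, mem_ofPred_eq, not_forall, not_not] at hx
  obtain ⟨hxU, hx0⟩ := hx
  refine ⟨?_, fun hi => by have := (interior_subset hi).2; linarith⟩
  have hsub : openSegment ℝ 0 x ⊆ {x ∈ K | w x < h + ⟪q, x⟫} := by
    rintro _ ⟨s, t, hs, ht, hst, rfl⟩
    refine ⟨hw.1 h0 (interior_subset hxU) hs.le ht.le hst, ?_⟩
    have h1 := (hw.concaveOn_add_inner_sub h q).2 h0 (interior_subset hxU) hs.le ht.le hst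
    simp only [hx0, hw0, inner_zero_right, smul_eq_mul] at h1
    have := mul_pos hs hh
    linarith
  refine closure_mono hsub ?_
  rw [closure_openSegment]
  exact right_mem_segment ℝ 0 x

theorem isCompact_setOf_forall_inner_le {K : Set (E n)} (h0 : (0 : E n) ∈ interior K) (m : ℝ) :
    IsCompact {q : E n | ∀ x ∈ K, ⟪q, x⟫ ≤ m} := by
  obtain ⟨r, hr, hrK⟩ := Metric.mem_nhds_iff.1 (mem_interior_iff_mem_nhds.1 h0)
  refine Metric.isCompact_of_isClosed_isBounded ?_ ?_
  · simp only [ofPred_forall]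
    exact isClosed_biInter fun x _ => isClosed_le (by fun_prop) continuous_const
  · refine isBounded_closedBall (x := (0 : E n)) (r := 2 * m / r) |>.subset fun q hq => ?_
    rw [mem_closedBall_zero_iff, le_div_iff₀ hr]
    rcases eq_or_ne q 0 with rfl | hq0
    · have := hq 0 (hrK (mem_ball_self hr))
      simp at this ⊢
      exact this
    have hqn : 0 < ‖q‖ := norm_pos_iff.2 hq0
    have h1 := hq ((r / 2 / ‖q‖) • q) (hrK (by
      rw [mem_ball_zero_iff, norm_smul, Real.norm_eq_abs, abs_of_pos (by positivity),
        div_mul_cancel₀ _ hqn.ne']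
      linarith))
    rw [real_inner_smul_right, real_inner_self_eq_norm_sq] at h1
    have h2 : r / 2 / ‖q‖ * ‖q‖ ^ 2 = r / 2 * ‖q‖ := by field_simp
    linarith

/-- The slope of the section is the constrained minimizer of the convex functional
`q ↦ ∫ (h + ⟪q, x⟫ - w x)⁺`. -/
theorem exists_slope_variational {K : Set (E n)} {w : E n → ℝ} {M h : ℝ} (hw : ConvexOn ℝ K w)
    (hb : Bornology.IsBounded K) (h0 : (0 : E n) ∈ interior K) (hw0 : w 0 = 0)
    (hM : ∀ x ∈ K, |w x| ≤ M) (hh : 0 < h) (hh1 : h < 1) :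
    ∃ q : E n, (∀ x ∈ K, ⟪q, x⟫ ≤ 1 - h) ∧ ∀ p : E n, (∀ x ∈ K, ⟪p, x⟫ ≤ 1 - h) →
      0 ≤ ⟪p - q, centerOfMass {x ∈ K | w x < h + ⟪q, x⟫}⟫ := by
  have hK0 : (0 : E n) ∈ K := interior_subset h0
  have hUm : MeasurableSet (interior K) := isOpen_interior.measurableSet
  have hUfin : volume (interior K) < ⊤ := (hb.subset interior_subset).measure_lt_top
  have : IsFiniteMeasure (volume.restrict (interior K)) := ⟨by simpa using hUfin⟩
  have hwI : Integrable w (volume.restrict (interior K)) :=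
    IntegrableOn.of_bound hUfin (hw.continuousOn_interior.aestronglyMeasurable hUm) M
      ((ae_restrict_mem hUm).mono fun x hx => hM x (interior_subset hx))
  have hid : IntegrableOn (fun x : E n => x) K :=
    (continuousOn_id.integrableOn_compact hb.isCompact_closure).mono_set subset_closure
  have hinner : ∀ p : E n, Integrable (fun x => ⟪p, x⟫) (volume.restrict (interior K)) :=
    fun p => (hid.mono_set interior_subset).const_inner p
  have haI : ∀ q : E n, Integrable (fun x => h + ⟪q, x⟫ - w x) (volume.restrict (interior K)) :=
    fun q => ((integrable_const h).add (hinner q)).sub hwI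
  set F : E n → ℝ := fun q => ∫ x in interior K, max (h + ⟪q, x⟫ - w x) 0 with hF
  have hFc : ContinuousOn F {q : E n | ∀ x ∈ K, ⟪q, x⟫ ≤ 1 - h} := by
    refine continuousOn_of_dominated (bound := fun _ => 1 + M)
      (fun q _ => (haI q).pos_part.aestronglyMeasurable) ?_ (integrable_const _) ?_
    · intro q hq
      refine (ae_restrict_mem hUm).mono fun x hx => ?_
      have h1 := hq x (interior_subset hx)
      have h2 := abs_le.1 (hM x (interior_subset hx))
      rw [Real.norm_eq_abs, abs_of_nonneg (le_max_right _ _)]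
      exact max_le (by linarith) (by linarith)
    · exact Filter.Eventually.of_forall fun x => by fun_prop
  obtain ⟨q, hq, hqmin⟩ := (isCompact_setOf_forall_inner_le h0 (1 - h)).exists_isMinOn
    ⟨0, fun x _ => by simpa using hh1.le⟩ hFc
  refine ⟨q, hq, fun p hp => ?_⟩
  have hder := hasDerivAt_integral_max_add_mul (haI q) (hinner (p - q))
    (ae_add_inner_sub_ne_zero hw hK0 hw0 hh q)
  have hFt : ∀ t : ℝ, ∫ x in interior K, max (h + ⟪q, x⟫ - w x + t * ⟪p - q, x⟫) 0
      = F (q + t • (p - q)) := fun t => by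
    simp only [hF, inner_add_left, real_inner_smul_left]
    congr 1
    ext x
    ring_nf
  simp only [hFt] at hder
  have hnonneg : 0 ≤ ∫ x in {x | 0 < h + ⟪q, x⟫ - w x}, ⟪p - q, x⟫
      ∂volume.restrict (interior K) := by
    refine ge_of_tendsto (hder.tendsto_slope_zero_right) ?_
    have hev : ∀ᶠ t in nhdsWithin (0 : ℝ) (Ioi 0), t < 1 :=
      Filter.Eventually.filter_mono nhdsWithin_le_nhds (gt_mem_nhds one_pos)
    filter_upwards [self_mem_nhdsWithin, hev] with t ht ht1
    have ht0 : (0 : ℝ) < t := ht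
    have hmem : q + t • (p - q) ∈ {q : E n | ∀ x ∈ K, ⟪q, x⟫ ≤ 1 - h} := by
      intro x hx
      have h1 := hq x hx
      have h2 := hp x hx
      simp only [inner_add_left, real_inner_smul_left, inner_sub_left]
      nlinarith
    have := hqmin hmem
    simp only [zero_smul, add_zero, zero_add, smul_eq_mul]
    exact mul_nonneg (inv_nonneg.2 ht0.le) (sub_nonneg.2 this)
  have hset : ∫ x in {x | 0 < h + ⟪q, x⟫ - w x}, ⟪p - q, x⟫ ∂volume.restrict (interior K)
      = ∫ x in {x ∈ K | w x < h + ⟪q, x⟫}, ⟪p - q, x⟫ := by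
    rw [Measure.restrict_restrict₀
      (nullMeasurableSet_lt aemeasurable_const (haI q).aemeasurable)]
    refine setIntegral_congr_set ?_
    have hUK : interior K =ᵐ[volume] K := interior_ae_eq_of_null_frontier (hw.1.addHaar_frontier _)
    have hrw : {x ∈ K | w x < h + ⟪q, x⟫} = {x | 0 < h + ⟪q, x⟫ - w x} ∩ K := by
      ext x
      simp [and_comm]
    rw [hrw]
    exact Filter.EventuallyEq.rfl.inter hUK
  have hSI : IntegrableOn (fun x : E n => x) {x ∈ K | w x < h + ⟪q, x⟫} :=
    hid.mono_set fun x hx => hx.1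
  rw [hset, integral_inner hSI] at hnonneg
  rw [centerOfMass, real_inner_smul_right]
  exact mul_nonneg (inv_nonneg.2 ENNReal.toReal_nonneg) hnonneg

theorem dBalanced_zero_iff {d : ℝ} {S : Set (E n)} :
    DBalanced d S 0 ↔ ∃ L : E n ≃ₗ[ℝ] E n,
      (∀ x ∈ S, ‖L x‖ < d) ∧ ∀ u, ‖u‖ < 1 → L.symm u ∈ S := by
  simp only [DBalanced, sub_zero, image_id']
  constructor
  · rintro ⟨A, hA, h1, h2⟩
    refine ⟨LinearEquiv.ofBijective A hA, fun x hx => ?_, fun u hu => ?_⟩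
    · simpa using h2 (mem_image_of_mem A hx)
    · obtain ⟨y, hy, hyu⟩ := h1 (mem_ball_zero_iff.2 hu)
      have : (LinearEquiv.ofBijective A hA).symm u = y := by
        rw [LinearEquiv.symm_apply_eq]; exact hyu.symm
      rwa [this]
  · rintro ⟨L, h1, h2⟩
    refine ⟨L, L.bijective, fun u hu => ⟨L.symm u, h2 u (mem_ball_zero_iff.1 hu), by simp⟩, ?_⟩
    rintro _ ⟨x, hx, rfl⟩
    simpa using h1 x hx

theorem DBalanced.mono {d d' : ℝ} {S : Set (E n)} (h : DBalanced d S 0) (hd : d ≤ d') :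
    DBalanced d' S 0 := by
  obtain ⟨L, h1, h2⟩ := dBalanced_zero_iff.1 h
  exact dBalanced_zero_iff.2 ⟨L, fun x hx => (h1 x hx).trans_le hd, h2⟩

theorem DBalanced.isBounded {d : ℝ} {S : Set (E n)} (h : DBalanced d S 0) :
    Bornology.IsBounded S := by
  obtain ⟨L, h1, -⟩ := dBalanced_zero_iff.1 h
  have h2 : Bornology.IsBounded (L.symm.toContinuousLinearEquiv '' ball 0 d) :=
    L.symm.toContinuousLinearEquiv.lipschitz.isBounded_image isBounded_ball
  exact h2.subset fun x hx => ⟨L x, by simpa using h1 x hx, by simp⟩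

theorem DBalanced.zero_mem_interior {d : ℝ} {S : Set (E n)} (h : DBalanced d S 0) :
    (0 : E n) ∈ interior S := by
  obtain ⟨L, -, h2⟩ := dBalanced_zero_iff.1 h
  have hsub : L ⁻¹' ball 0 1 ⊆ S := fun x hx => by
    simpa using h2 (L x) (mem_ball_zero_iff.1 hx)
  exact interior_maximal hsub (isOpen_ball.preimage L.toContinuousLinearEquiv.continuous)
    (by simp)

theorem DBalanced.neg_inv_smul_mem {d : ℝ} (hd : 0 < d) {S : Set (E n)} (h : DBalanced d S 0)
    {x : E n} (hx : x ∈ S) : -(d⁻¹ • x) ∈ S := by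
  obtain ⟨L, h1, h2⟩ := dBalanced_zero_iff.1 h
  have := h2 (-(d⁻¹ • L x)) (by
    rw [norm_neg, norm_smul, norm_inv, Real.norm_eq_abs, abs_of_pos hd, inv_mul_lt_iff₀ hd]
    simpa using h1 x hx)
  simpa using this

/-- If a ball around `L x` lies in `L '' S` and the ray from `x` through the origin stays in `S`
up to `-t x`, then `S` is balanced around the origin. -/
theorem dBalanced_of_neg_smul_mem {S : Set (E n)} (hS : Convex ℝ S) {L : E n ≃ₗ[ℝ] E n}
    {c R t : ℝ} (hc : 0 < c) (ht : 0 < t) {x : E n} (hLR : ∀ y ∈ S, ‖L y‖ < R)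
    (hLc : ∀ u, ‖u - L x‖ < c → L.symm u ∈ S) (htx : -(t • x) ∈ S) :
    DBalanced (R / c * (1 + t⁻¹)) S 0 := by
  have ha : 0 < c⁻¹ * (1 + t⁻¹) := by positivity
  have hane := ha.ne'
  refine dBalanced_zero_iff.2 ⟨L.trans (LinearEquiv.smulOfNeZero ℝ (E n) _ hane), ?_, ?_⟩
  · intro y hy
    rw [LinearEquiv.trans_apply, LinearEquiv.smulOfNeZero_apply, norm_smul, Real.norm_eq_abs,
      abs_of_pos ha]
    calc c⁻¹ * (1 + t⁻¹) * ‖L y‖ < c⁻¹ * (1 + t⁻¹) * R := mul_lt_mul_of_pos_left (hLR y hy) ha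
      _ = R / c * (1 + t⁻¹) := by ring
  · intro u hu
    have h1 := hLc (L x + c • u) (by
      rw [add_sub_cancel_left, norm_smul, Real.norm_eq_abs, abs_of_pos hc]
      exact mul_lt_of_lt_one_right hc hu)
    have h2 := hS h1 htx (a := t / (1 + t)) (b := 1 / (1 + t)) (by positivity) (by positivity)
      (by field_simp; ring)
    convert h2 using 1
    rw [LinearEquiv.symm_apply_eq]
    simp only [LinearEquiv.trans_apply, LinearEquiv.smulOfNeZero_apply, map_add, map_smul,
      map_neg, LinearEquiv.apply_symm_apply, smul_add, smul_neg, smul_smul]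
    have e1 : t / (1 + t) * (c⁻¹ * (1 + t⁻¹)) = c⁻¹ := by field_simp; ring
    have e2 : 1 / (1 + t) * t * (c⁻¹ * (1 + t⁻¹)) = c⁻¹ := by field_simp; ring
    have e3 : t / (1 + t) * c * (c⁻¹ * (1 + t⁻¹)) = 1 := by field_simp; ring
    rw [e1, e2, e3]
    simp

theorem volume_image_add_linearMap_closedBall (x : E n) (A : E n →ₗ[ℝ] E n) :
    (volume ((fun y => x + A y) '' closedBall (0 : E n) 1)).toReal
      = |LinearMap.det A| * (volume (closedBall (0 : E n) 1)).toReal := by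
  have : (fun y => x + A y) '' closedBall (0 : E n) 1
      = (fun y => x + y) '' (A '' closedBall (0 : E n) 1) := by rw [image_image]
  rw [this, image_add_left, measure_preimage_add, Measure.addHaar_image_linearMap,
    ENNReal.toReal_mul, ENNReal.toReal_ofReal (abs_nonneg _)]

/-- An ellipsoid around the origin is thin in the direction of a point `x` lying far below the
half-space `⟪q, ·⟫ ≤ m`; stretching it towards `x` yields a much larger ellipsoid around `x`. -/
theorem maxEllVol_le_maxEllVol {K : Set (E n)} (hK : Convex ℝ K) (hb : Bornology.IsBounded K)
    (h0 : (0 : E n) ∈ K) {q x : E n} {m N δ : ℝ} (hm : 0 < m) (hN : 0 < N) (hδ : 0 < δ)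
    (hq : ∀ y ∈ K, ⟪q, y⟫ ≤ m) (hqx : ⟪q, x⟫ ≤ -(m * N)) (hxK : (1 + δ) • x ∈ K) :
    (δ / (2 + δ)) ^ n * N * maxEllVol K 0 ≤ maxEllVol K x := by
  set κ := δ / (2 + δ) with hκ
  have hκ0 : 0 < κ := by positivity
  have hκδ : κ * (2 + δ) = δ := by rw [hκ]; field_simp
  have hbdd : BddAbove {v : ℝ | ∃ A : E n →ₗ[ℝ] E n, Function.Bijective A ∧
      (fun y => x + A y) '' closedBall (0 : E n) 1 ⊆ K ∧
      v = (volume ((fun y => x + A y) '' closedBall (0 : E n) 1)).toReal} := by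
    refine ⟨(volume K).toReal, ?_⟩
    rintro v ⟨A, -, hA, rfl⟩
    exact ENNReal.toReal_mono hb.measure_lt_top.ne (measure_mono hA)
  have hnn : 0 ≤ maxEllVol K x := Real.sSup_nonneg (by rintro v ⟨A, -, -, rfl⟩; positivity)
  have hκN : 0 < κ ^ n * N := by positivity
  rw [mul_comm, ← le_div_iff₀ hκN]
  refine Real.sSup_le ?_ (by positivity)
  rintro v ⟨A, hA, hAK, rfl⟩
  rw [le_div_iff₀ hκN]
  obtain ⟨e, he⟩ : ∃ e : E n ≃ₗ[ℝ] E n, (e : E n →ₗ[ℝ] E n) = A :=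
    ⟨LinearEquiv.ofBijective A hA, rfl⟩
  set z := e.symm x with hz
  have hAz : A z = x := by rw [← he]; simp [hz]
  have hAK' : ∀ u, ‖u‖ ≤ 1 → A u ∈ K := fun u hu =>
    hAK ⟨u, mem_closedBall_zero_iff.2 hu, by simp⟩
  have hz0 : z ≠ 0 := by
    intro h
    rw [h, map_zero] at hAz
    rw [← hAz, inner_zero_right] at hqx
    have := mul_pos hm hN
    linarith
  have hzpos : 0 < ‖z‖ := norm_pos_iff.2 hz0
  have hzN : N ≤ ‖z‖ := by
    have h1 := hq _ (hAK' (-(‖z‖⁻¹ • z)) (by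
      rw [norm_neg, norm_smul, norm_inv, norm_norm, inv_mul_cancel₀ hzpos.ne']))
    rw [map_neg, map_smul, hAz, inner_neg_right, real_inner_smul_right, ← mul_neg,
      inv_mul_le_iff₀ hzpos] at h1
    have h2 : m * N ≤ m * ‖z‖ := by linarith
    exact le_of_mul_le_mul_left h2 hm
  set f : E n →ₗ[ℝ] ℝ := innerₛₗ ℝ (‖z‖⁻¹ • z) with hf
  have hfz : f z = ‖z‖ := by
    simp only [hf, innerₛₗ_apply_apply, real_inner_smul_left,
      real_inner_self_eq_norm_sq]
    field_simp
  have hfu : ∀ u, ‖u‖ ≤ 1 → |f u| ≤ 1 := fun u hu => by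
    simp only [hf, innerₛₗ_apply_apply]
    refine (abs_real_inner_le_norm _ _).trans ?_
    rw [norm_smul, norm_inv, norm_norm, inv_mul_cancel₀ hzpos.ne', one_mul]
    exact hu
  set A' : E n →ₗ[ℝ] E n := κ • (A ∘ₗ LinearMap.transvection f z) with hA'
  have hdet : LinearMap.det A' = κ ^ n * (1 + ‖z‖) * LinearMap.det A := by
    rw [hA', LinearMap.det_smul, LinearMap.det_comp, LinearMap.transvection.det, hfz,
      finrank_euclideanSpace_fin]
    ring
  have hAdet : LinearMap.det A ≠ 0 := by rw [← he]; exact (LinearEquiv.isUnit_det' e).ne_zero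
  have hdet0 : LinearMap.det A' ≠ 0 := by
    rw [hdet]
    exact mul_ne_zero (by positivity) hAdet
  have hbij : Function.Bijective A' := (LinearMap.equivOfDetNeZero A' hdet0).bijective
  have hmem : (fun y => x + A' y) '' closedBall (0 : E n) 1 ⊆ K := by
    rintro _ ⟨u, hu, rfl⟩
    have hu1 : ‖u‖ ≤ 1 := mem_closedBall_zero_iff.1 hu
    have hfu1 := abs_le.1 (hfu u hu1)
    have hAu : x + A' u = ((1 + κ * f u) / (1 + δ)) • ((1 + δ) • x) + κ • A u := by
      simp only [hA', LinearMap.smul_apply, LinearMap.comp_apply, LinearMap.transvection.apply,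
        map_add, map_smul, hAz, smul_smul]
      rw [div_mul_cancel₀ _ (by positivity)]
      module
    have hκ1 : κ < 1 := by rw [hκ, div_lt_one (by positivity)]; linarith
    have hα : 0 ≤ (1 + κ * f u) / (1 + δ) := div_nonneg (by nlinarith) (by positivity)
    have hsum : (1 + κ * f u) / (1 + δ) + κ ≤ 1 := by
      rw [← le_sub_iff_add_le, div_le_iff₀ (by positivity)]
      nlinarith
    have h3 := hK.sum_mem (t := (Finset.univ : Finset (Fin 3)))
      (w := ![(1 + κ * f u) / (1 + δ), κ, 1 - ((1 + κ * f u) / (1 + δ) + κ)])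
      (z := ![(1 + δ) • x, A u, 0]) (by
        intro i _
        fin_cases i
        · exact hα
        · exact hκ0.le
        · exact sub_nonneg.2 hsum) (by simp [Fin.sum_univ_three]) (by
        intro i _
        fin_cases i
        · exact hxK
        · exact hAK' u hu1
        · exact h0)
    simp only [hAu]
    simpa [Fin.sum_univ_three] using h3
  refine le_trans ?_ (le_csSup hbdd ⟨A', hbij, hmem, rfl⟩)
  rw [volume_image_add_linearMap_closedBall, volume_image_add_linearMap_closedBall, hdet, abs_mul,
    abs_of_pos (show 0 < κ ^ n * (1 + ‖z‖) by positivity)]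
  have h4 : κ ^ n * N ≤ κ ^ n * (1 + ‖z‖) :=
    mul_le_mul_of_nonneg_left (by linarith) (by positivity)
  have h5 : 0 ≤ |LinearMap.det A| * (volume (closedBall (0 : E n) 1)).toReal := by positivity
  nlinarith [mul_le_mul_of_nonneg_right h4 h5]

theorem ConvexOn.map_smul_le_of_map_zero {K : Set (E n)} {w : E n → ℝ} (hw : ConvexOn ℝ K w)
    (h0 : (0 : E n) ∈ K) (hw0 : w 0 = 0) {x : E n} (hx : x ∈ K) {t : ℝ} (ht : 0 ≤ t)
    (ht1 : t ≤ 1) : w (t • x) ≤ t * w x := by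
  simpa [hw0] using hw.2 hx h0 ht (sub_nonneg.2 ht1) (by ring)

theorem section_subset_sublevel {Ω : Set (E n)} {w : E n → ℝ} {h : ℝ} {q : E n}
    (hw : ConvexOn ℝ Ω w) (h0 : (0 : E n) ∈ Ω) (hw0 : w 0 = 0) (hh : 0 < h)
    (hq : ∀ x ∈ {x ∈ Ω | w x < 1}, ⟪q, x⟫ ≤ 1 - h) :
    {x ∈ Ω | w x < h + ⟪q, x⟫} ⊆ {x ∈ Ω | w x < 1} := by
  rintro x ⟨hx, hxq⟩
  refine ⟨hx, ?_⟩
  by_contra! hx1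
  have hwx : 0 < w x := by linarith
  have key : ∀ t ∈ Ico (0 : ℝ) (w x)⁻¹, t * ⟪q, x⟫ ≤ 1 - h := by
    rintro t ⟨ht0, ht1⟩
    have htw : t * w x < 1 := by rwa [← one_div, lt_div_iff₀ hwx] at ht1
    have ht1' : t ≤ 1 := ht1.le.trans (inv_le_one_of_one_le₀ hx1)
    have hle := hw.map_smul_le_of_map_zero h0 hw0 hx ht0 ht1'
    have := hq (t • x) ⟨(hw.1.starConvex h0).smul_mem hx ht0 ht1', hle.trans_lt htw⟩
    rwa [real_inner_smul_right] at this
  have hlim : (w x)⁻¹ * ⟪q, x⟫ ≤ 1 - h := by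
    refine le_of_tendsto (f := fun t : ℝ => t * ⟪q, x⟫) (x := nhdsWithin (w x)⁻¹ (Iio (w x)⁻¹))
      ?_ ?_
    · exact (continuous_id.mul continuous_const).continuousWithinAt
    · filter_upwards [Ico_mem_nhdsLT (inv_pos.2 hwx)] with t ht using key t ht
  rw [inv_mul_le_iff₀ hwx] at hlim
  nlinarith

theorem DBalanced.abs_apply_le {K : Set (E n)} {w : E n → ℝ} {d : ℝ} (hd : 1 ≤ d)
    (hK : DBalanced d K 0) (hw : ConvexOn ℝ K w) (hw0 : w 0 = 0) (hw1 : ∀ x ∈ K, w x < 1)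
    {x : E n} (hx : x ∈ K) : |w x| ≤ d := by
  have hd0 : 0 < d := one_pos.trans_le hd
  refine abs_le.2 ⟨?_, (hw1 x hx).le.trans hd⟩
  have hy := hK.neg_inv_smul_mem hd0 hx
  have h1 := hw.2 hx hy (show (0 : ℝ) ≤ 1 / (1 + d) by positivity)
    (show (0 : ℝ) ≤ d / (1 + d) by positivity) (by field_simp)
  have h2 : (1 / (1 + d)) • x + (d / (1 + d)) • -(d⁻¹ • x) = 0 := by
    rw [smul_neg, smul_smul, div_mul_eq_mul_div, mul_inv_cancel₀ hd0.ne', add_neg_cancel]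
  rw [h2, hw0, smul_eq_mul, smul_eq_mul, div_mul_eq_mul_div, div_mul_eq_mul_div, ← add_div,
    le_div_iff₀ (by positivity)] at h1
  nlinarith [hw1 _ hy]

/-- Optimality of the slope `q`: unless the center of mass `x` of the section is the origin, the
ray from `x` through the origin leaves `K` through the supporting hyperplane `⟪q, ·⟫ = 1 - h`,
and a fixed fraction of it stays in the section. -/
theorem exists_neg_smul_mem_section {K : Set (E n)} {w : E n → ℝ} {h : ℝ} {q x : E n}
    (hw : ConvexOn ℝ K w) (hb : Bornology.IsBounded K) (h0 : (0 : E n) ∈ interior K)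
    (hw0 : w 0 = 0) (hw1 : ∀ x ∈ K, w x < 1) (hh : 0 < h) (hh1 : h < 1)
    (hmin : ∀ p : E n, (∀ y ∈ K, ⟪p, y⟫ ≤ 1 - h) → 0 ≤ ⟪p - q, x⟫) :
    x = 0 ∨ ∃ s : ℝ, 0 < s ∧ s * ⟪q, x⟫ = -(1 - h) ∧
      -((s / 4) • x) ∈ {x ∈ K | w x < h + ⟪q, x⟫} := by
  have hK0 : (0 : E n) ∈ K := interior_subset h0
  have hsep : ∀ s : ℝ, 0 < s → s * -⟪q, x⟫ < 1 - h → -(s • x) ∈ K := by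
    intro s hs hsq
    by_contra hnot
    obtain ⟨f, hf⟩ := geometric_hahn_banach_open_point hw.1.interior isOpen_interior
      (fun hi => hnot (interior_subset hi))
    have hf0 : 0 < f (-(s • x)) := by simpa using hf 0 h0
    have hfK : ∀ y ∈ K, f y ≤ f (-(s • x)) := by
      intro y hy
      have hy' : y ∈ closure (interior K) := by
        rw [hw.1.closure_interior_eq_closure_of_nonempty_interior ⟨0, h0⟩]
        exact subset_closure hy
      exact le_on_closure (fun a ha => (hf a ha).le) f.continuous.continuousOn
        continuousOn_const hy'
    set v := (InnerProductSpace.toDual ℝ (E n)).symm f with hv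
    have hvf : ∀ y, ⟪v, y⟫ = f y := fun y => by simp [hv]
    have hkey := hmin (((1 - h) / f (-(s • x))) • v) (by
      intro y hy
      rw [real_inner_smul_left, hvf, div_mul_eq_mul_div, div_le_iff₀ hf0]
      exact mul_le_mul_of_nonneg_left (hfK y hy) (by linarith))
    rw [inner_sub_left, real_inner_smul_left, hvf] at hkey
    have h1 : s * ((1 - h) / f (-(s • x)) * f x) = -(1 - h) := by
      have h2 : s * f x = -f (-(s • x)) := by simp
      rw [mul_left_comm, h2]
      field_simp
    nlinarith [mul_nonneg hs.le hkey]
  by_cases hx : x = 0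
  · exact Or.inl hx
  right
  have hneg : ⟪q, x⟫ < 0 := by
    by_contra! hnn
    obtain ⟨M, hM⟩ := hb.exists_norm_le
    have hxpos : 0 < ‖x‖ := norm_pos_iff.2 hx
    have hM0 : 0 ≤ M := (norm_nonneg _).trans (hM 0 hK0)
    have h1 := hM _ (hsep ((M + 1) / ‖x‖) (by positivity) (by
      have : 0 ≤ (M + 1) / ‖x‖ * ⟪q, x⟫ := by positivity
      linarith))
    rw [norm_neg, norm_smul, norm_div, norm_norm, div_mul_cancel₀ _ hxpos.ne',
      Real.norm_eq_abs] at h1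
    linarith [le_abs_self (M + 1)]
  have h1h : 0 < 1 - h := sub_pos.2 hh1
  obtain ⟨s, hs⟩ : ∃ s : ℝ, s = (1 - h) / -⟪q, x⟫ := ⟨_, rfl⟩
  have hs0 : 0 < s := by rw [hs]; exact div_pos h1h (neg_pos.2 hneg)
  have hsq : s * -⟪q, x⟫ = 1 - h := by rw [hs]; exact div_mul_cancel₀ _ (neg_pos.2 hneg).ne'
  have hy := hsep ((1 - h / 2) * s) (by nlinarith) (by rw [mul_assoc, hsq]; nlinarith)
  have hsmul : ∀ a b : ℝ, a • -(b • x) = -((a * b) • x) := fun a b => by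
    rw [smul_neg, smul_smul]
  obtain ⟨a, ha⟩ : ∃ a : ℝ, a = 1 / 4 / (1 - h / 2) := ⟨_, rfl⟩
  have hden : 0 < 1 - h / 2 := by linarith
  have ha' : a * (1 - h / 2) = 1 / 4 := by rw [ha]; exact div_mul_cancel₀ _ hden.ne'
  have ha0 : 0 < a := by rw [ha]; positivity
  have ha1 : a ≤ 1 / 2 := by nlinarith
  have heq : a • -(((1 - h / 2) * s) • x) = -((s / 4) • x) := by
    rw [hsmul, ← mul_assoc, ha']
    congr 2
    ring
  refine ⟨s, hs0, by linarith, ?_⟩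
  rw [← heq]
  refine ⟨(hw.1.starConvex hK0).smul_mem hy ha0.le (by linarith), ?_⟩
  have h2 := hw.map_smul_le_of_map_zero hK0 hw0 hy ha0.le (by linarith)
  have h3 := hw1 _ hy
  have h4 : ⟪q, a • -(((1 - h / 2) * s) • x)⟫ = 1 / 4 * (1 - h) := by
    rw [heq, inner_neg_right, real_inner_smul_right]
    linarith
  rw [h4]
  have h5 : a < h + 1 / 4 * (1 - h) := by
    rw [ha, div_lt_iff₀ hden]
    nlinarith
  nlinarith


theorem zero_mem_interior_section {K : Set (E n)} {w : E n → ℝ} {h : ℝ} {q : E n}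
    (hw : ConvexOn ℝ K w) (h0 : (0 : E n) ∈ interior K) (hw0 : w 0 = 0) (hh : 0 < h) :
    (0 : E n) ∈ interior {x ∈ K | w x < h + ⟪q, x⟫} := by
  have hc : ContinuousAt w 0 :=
    hw.continuousOn_interior.continuousAt (isOpen_interior.mem_nhds h0)
  have hlin : ContinuousAt (fun x : E n => h + ⟪q, x⟫) 0 := by fun_prop
  rw [mem_interior_iff_mem_nhds] at h0 ⊢
  exact Filter.inter_mem h0 (hc.eventually_lt hlin (by simpa [hw0] using hh))

/-- Lemma 2.5: existence of balanced sections at all lower heights. -/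
theorem stmt18 (n : ℕ) :
    ∃ Cn : ℝ, 0 < Cn ∧ ∃ Cn' : ℝ, 0 < Cn' ∧
      ∀ (Ω : Set (E n)) (w : E n → ℝ) (d : ℝ),
        Convex ℝ Ω → ConvexOn ℝ Ω w → (0 : E n) ∈ Ω → w 0 = 0 → 1 ≤ d →
        IsCompact (closure {x ∈ Ω | w x < 1}) →
        closure {x ∈ Ω | w x < 1} ⊆ Ω →
        DBalanced d {x ∈ Ω | w x < 1} 0 →
        ∀ h : ℝ, 0 < h → h < 1 →
          ∃ q : E n,
            {x ∈ Ω | w x < h + ⟪q, x⟫} ⊆ {x ∈ Ω | w x < 1} ∧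
            DBalanced (Cn * d) {x ∈ Ω | w x < h + ⟪q, x⟫} 0 ∧
            (DBalanced Cn' {x ∈ Ω | w x < h + ⟪q, x⟫} 0 ∨
              2 * maxEllVol {x ∈ Ω | w x < 1} 0 ≤
                maxEllVol {x ∈ Ω | w x < 1}
                  (centerOfMass {x ∈ Ω | w x < h + ⟪q, x⟫})) := by
  obtain ⟨c, hc, R, hR, hball⟩ := exists_linearEquiv_ball_centerOfMass n
  obtain ⟨δ, hδ⟩ : ∃ δ : ℝ, δ = c / R := ⟨_, rfl⟩
  have hδ0 : 0 < δ := by rw [hδ]; positivity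
  obtain ⟨κ, hκ⟩ : ∃ κ : ℝ, κ = δ / (2 + δ) := ⟨_, rfl⟩
  have hκ0 : 0 < κ := by rw [hκ]; positivity
  obtain ⟨N, hN⟩ : ∃ N : ℝ, N = 2 / κ ^ n := ⟨_, rfl⟩
  have hN0 : 0 < N := by rw [hN]; positivity
  have hκN : κ ^ n * N = 2 := by rw [hN]; field_simp
  have hRc : 0 < R / c := by positivity
  refine ⟨R / c * 5, by positivity, R / c * (2 + 4 * N), by positivity, ?_⟩
  intro Ω w d hΩ hw h0 hw0 hd _ _ hbal h hh hh1
  have hd0 : 0 < d := one_pos.trans_le hd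
  obtain ⟨K, hK⟩ : ∃ K : Set (E n), K = {x ∈ Ω | w x < 1} := ⟨_, rfl⟩
  rw [← hK] at hbal ⊢
  have hKΩ : K ⊆ Ω := by rw [hK]; exact sep_subset _ _
  have hw1 : ∀ x ∈ K, w x < 1 := by rw [hK]; exact fun x hx => hx.2
  have hKc : Convex ℝ K := by rw [hK]; exact hw.convex_lt 1
  have hwK : ConvexOn ℝ K w := hw.subset hKΩ hKc
  have hKb := hbal.isBounded
  have hK0 := hbal.zero_mem_interior
  obtain ⟨q, hq, hmin⟩ := exists_slope_variational hwK hKb hK0 hw0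
    (fun x hx => hbal.abs_apply_le hd hwK hw0 hw1 hx) hh hh1
  have hsub : {x ∈ Ω | w x < h + ⟪q, x⟫} ⊆ K := by
    rw [hK]
    exact section_subset_sublevel hw h0 hw0 hh (by rwa [← hK])
  have heq : {x ∈ Ω | w x < h + ⟪q, x⟫} = {x ∈ K | w x < h + ⟪q, x⟫} :=
    Subset.antisymm (fun x hx => ⟨hsub hx, hx.2⟩) fun x hx => ⟨hKΩ hx.1, hx.2⟩
  refine ⟨q, hsub, ?_⟩
  rw [heq] at hsub ⊢
  obtain ⟨S, hS⟩ : ∃ S : Set (E n), S = {x ∈ K | w x < h + ⟪q, x⟫} := ⟨_, rfl⟩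
  have hS0 : (0 : E n) ∈ interior S := by
    rw [hS]
    exact zero_mem_interior_section hwK hK0 hw0 hh
  have hSc : Convex ℝ S := by rw [hS]; exact hwK.convex_section h q
  obtain ⟨x, hx⟩ : ∃ x : E n, x = centerOfMass S := ⟨_, rfl⟩
  have hray := exists_neg_smul_mem_section hwK hKb hK0 hw0 hw1 hh hh1 hmin
  rw [← hS] at hray hsub ⊢
  rw [← hx] at hray ⊢
  obtain ⟨L, hLR, hLc⟩ := hball S hSc (hKb.subset hsub) hS0
  rw [← hx] at hLc
  replace hLc : ∀ u, ‖u - L x‖ < c → L.symm u ∈ S := fun u hu => interior_subset (hLc u hu)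
  have hxS : x ∈ S := by simpa using hLc (L x) (by simpa using hc)
  rcases hray with hx0 | ⟨s, hs0, hsq, hs⟩
  · have hb := dBalanced_of_neg_smul_mem hSc hc one_pos hLR hLc
      (by simpa [hx0] using interior_subset hS0)
    rw [inv_one] at hb
    refine ⟨hb.mono ?_, Or.inl (hb.mono ?_)⟩
    · rw [mul_assoc]
      exact mul_le_mul_of_nonneg_left (by linarith) hRc.le
    · exact mul_le_mul_of_nonneg_left (by linarith) hRc.le
  · have hb := dBalanced_of_neg_smul_mem hSc hc (by positivity : 0 < s / 4) hLR hLc hs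
    have hinv : (s / 4)⁻¹ = 4 * s⁻¹ := by rw [inv_div, div_eq_mul_inv]
    rw [hinv] at hb
    have h1h : 0 < 1 - h := sub_pos.2 hh1
    have hqx : ⟪q, x⟫ = -((1 - h) * s⁻¹) := by
      field_simp
      linarith
    have hsd : s⁻¹ ≤ d := by
      have h1 := hq _ (hbal.neg_inv_smul_mem hd0 (hsub hxS))
      rw [inner_neg_right, real_inner_smul_right, hqx, mul_neg, neg_neg,
        inv_mul_le_iff₀ hd0, mul_comm d] at h1
      exact le_of_mul_le_mul_left h1 h1h
    refine ⟨hb.mono ?_, ?_⟩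
    · rw [mul_assoc]
      exact mul_le_mul_of_nonneg_left (by linarith) hRc.le
    rcases le_total s⁻¹ N with hsN | hsN
    · exact Or.inl (hb.mono (mul_le_mul_of_nonneg_left (by linarith) hRc.le))
    · right
      have hxK : (1 + δ) • x ∈ K := by
        refine hsub ?_
        have h1 := hLc ((1 + δ) • L x) (by
          rw [add_smul, one_smul, add_sub_cancel_left, norm_smul, Real.norm_eq_abs,
            abs_of_pos hδ0]
          calc δ * ‖L x‖ < δ * R := mul_lt_mul_of_pos_left (hLR x hxS) hδ0
            _ = c := by rw [hδ]; field_simp)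
        simpa using h1
      have h1 := maxEllVol_le_maxEllVol hKc hKb (interior_subset hK0) h1h hN0 hδ0 hq
        (by rw [hqx]; exact neg_le_neg (mul_le_mul_of_nonneg_left hsN h1h.le)) hxK
      rwa [← hκ, hκN] at h1
end
end

section
/- Let f : ℝ → ℝ be convex with f(0) = 0 and let q ∈ ℝ be a subgradient of f at 0, i.e. f(x) ≥ q x for all x ∈ ℝ. For h > 0 and α′ > 0, write (h, α′) ∈ A(f) if there exist q₁, q₂ ∈ ℝ with q₁ − q₂ ≥ α′ and f(x) ≥ −h + max(q₁ x, q₂ x) for all x ∈ ℝ. Let a > 0 and α > 0. Then: (i) if f(x₀) − q x₀ ≥ a |x₀|^{1+α} for some x₀ ≠ 0, then, setting h := a |x₀|^{1+α}, one has (h, a^{1/(1+α)} h^{α/(1+α)}) ∈ A(f); (ii) conversely, if (h, a^{1/(1+α)} h^{α/(1+α)}) ∈ A(f) for some h > 0, then there exists x with |x| = 4 (h/a)^{1/(1+α)} and f(x) − q x ≥ (a / 4^{1+α}) |x|^{1+α}. -/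
open Set Metric MeasureTheory
open scoped RealInnerProductSpace

noncomputable section

variable {n : ℕ}

/-- `(h, a') ∈ A(f)`: an angle of opening `a'` with vertex at `-h` lies below `f`. -/
def Af (f : ℝ → ℝ) (h a' : ℝ) : Prop :=
  ∃ q₁ q₂ : ℝ, a' ≤ q₁ - q₂ ∧ ∀ x : ℝ, -h + max (q₁ * x) (q₂ * x) ≤ f x

/-- A convex function vanishing at `0` grows at least linearly along rays from `0`. -/
lemma ConvexOn.mul_le_of_one_le {f : ℝ → ℝ} (hf : ConvexOn ℝ Set.univ f) (hf0 : f 0 = 0)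
    {t : ℝ} (ht : 1 ≤ t) (x : ℝ) : t * f x ≤ f (t * x) := by
  have ht0 : 0 < t := by linarith
  have h := hf.2 (mem_univ (t * x)) (mem_univ 0) (inv_nonneg.2 ht0.le)
    (sub_nonneg.2 (inv_le_one_of_one_le₀ ht)) (by ring : t⁻¹ + (1 - t⁻¹) = 1)
  simp only [smul_eq_mul, mul_zero, add_zero, hf0, inv_mul_cancel_left₀ ht0.ne'] at h
  calc t * f x ≤ t * (t⁻¹ * f (t * x)) := by gcongr
    _ = f (t * x) := by field_simp

/-- A function above the linear function of slope `q` and above the line through `(0, -h)` of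
slope `q + p` has an angle of opening `|p|` with vertex at `-h` below it. -/
lemma Af_of_slope {f : ℝ → ℝ} {q h p : ℝ} (hh : 0 ≤ h) (hq : ∀ x, q * x ≤ f x)
    (hp : ∀ x, -h + (q + p) * x ≤ f x) : Af f h |p| := by
  rcases le_total 0 p with hp0 | hp0
  · refine ⟨q + p, q, by rw [abs_of_nonneg hp0]; linarith, fun x => ?_⟩
    have := max_le (a := (q + p) * x) (b := q * x) (c := f x + h)
      (by linarith [hp x]) (by linarith [hq x])
    linarith
  · refine ⟨q, q + p, by rw [abs_of_nonpos hp0]; linarith, fun x => ?_⟩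
    have := max_le (a := q * x) (b := (q + p) * x) (c := f x + h)
      (by linarith [hq x]) (by linarith [hp x])
    linarith

/-- If `h = a * s ^ (1 + α)`, then `a ^ (1 / (1 + α)) * h ^ (α / (1 + α)) = h / s`. -/
lemma rpow_opening_eq_div {a α s : ℝ} (ha : 0 < a) (hα : 0 < α) (hs : 0 < s) :
    a ^ ((1:ℝ) / (1 + α)) * (a * s ^ (1 + α)) ^ (α / (1 + α)) = a * s ^ (1 + α) / s := by
  have h1 : 1 + α ≠ 0 := by positivity
  have hsum : (1:ℝ) / (1 + α) + α / (1 + α) = 1 := by field_simp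
  rw [Real.mul_rpow ha.le (by positivity), ← mul_assoc, ← Real.rpow_add ha, hsum, Real.rpow_one,
    ← Real.rpow_mul hs.le, mul_div_cancel₀ _ h1, Real.rpow_add hs, Real.rpow_one]
  field_simp

/-- Lemma 7.2: relation between the sets `A(f)` and pointwise `C^{1,α}`
behavior of a one-dimensional convex function. -/
theorem stmt19 (f : ℝ → ℝ) (hf : ConvexOn ℝ Set.univ f) (hf0 : f 0 = 0)
    (q : ℝ) (hq : ∀ x : ℝ, q * x ≤ f x) (a α : ℝ) (ha : 0 < a) (hα : 0 < α) :
    (∀ x₀ : ℝ, x₀ ≠ 0 → a * |x₀| ^ (1 + α) ≤ f x₀ - q * x₀ →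
      Af f (a * |x₀| ^ (1 + α))
        (a ^ ((1:ℝ) / (1 + α)) * (a * |x₀| ^ (1 + α)) ^ (α / (1 + α)))) ∧
    (∀ h : ℝ, 0 < h →
      Af f h (a ^ ((1:ℝ) / (1 + α)) * h ^ (α / (1 + α))) →
      ∃ x : ℝ, |x| = 4 * (h / a) ^ ((1:ℝ) / (1 + α)) ∧
        a / 4 ^ (1 + α) * |x| ^ (1 + α) ≤ f x - q * x) := by
  constructor
  · intro x₀ hx₀ hfx₀
    rw [rpow_opening_eq_div ha hα (abs_pos.2 hx₀)]
    set h := a * |x₀| ^ (1 + α) with hdef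
    have hh : 0 ≤ h := by positivity
    have hcv : ConvexOn ℝ Set.univ fun x => f x - q * x :=
      hf.sub ((LinearMap.mulLeft ℝ q).concaveOn convex_univ)
    rw [← abs_of_nonneg hh, ← abs_div, abs_of_nonneg hh]
    refine Af_of_slope hh hq fun x => ?_
    obtain ⟨t, rfl⟩ : ∃ t, x = t * x₀ := ⟨x / x₀, by field_simp⟩
    have hcalc : (q + h / x₀) * (t * x₀) = q * (t * x₀) + t * h := by field_simp
    rw [hcalc]
    rcases le_total t 1 with ht | ht
    · nlinarith [hq (t * x₀)]
    · have hgrow := hcv.mul_le_of_one_le (by simp [hf0]) ht x₀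
      have : t * h ≤ t * (f x₀ - q * x₀) := by gcongr
      linarith
  · rintro h hh ⟨q₁, q₂, hgap, hang⟩
    set s := (h / a) ^ ((1:ℝ) / (1 + α)) with hsdef
    have hs : 0 < s := by positivity
    have hsh : a * s ^ (1 + α) = h := by
      rw [hsdef, ← Real.rpow_mul (by positivity), one_div_mul_cancel (by positivity),
        Real.rpow_one]
      field_simp
    have hopen := rpow_opening_eq_div ha hα hs
    rw [hsh] at hopen
    rw [hopen, div_le_iff₀ hs] at hgap
    have hval : a / 4 ^ (1 + α) * (4 * s) ^ (1 + α) = h := by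
      rw [Real.mul_rpow (by norm_num) hs.le, ← hsh]
      field_simp
    rcases le_total (q₁ + q₂) (2 * q) with hmid | hmid
    · have habs : |(-(4 * s))| = 4 * s := by rw [abs_neg, abs_of_pos (by positivity)]
      refine ⟨-(4 * s), habs, ?_⟩
      rw [habs, hval]
      have := hang (-(4 * s))
      have := le_max_right (q₁ * -(4 * s)) (q₂ * -(4 * s))
      nlinarith [mul_le_mul_of_nonneg_right hmid hs.le]
    · have habs : |4 * s| = 4 * s := abs_of_pos (by positivity)
      refine ⟨4 * s, habs, ?_⟩
      rw [habs, hval]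
      have := hang (4 * s)
      have := le_max_left (q₁ * (4 * s)) (q₂ * (4 * s))
      nlinarith [mul_le_mul_of_nonneg_right hmid hs.le]
end
end
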